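/- With the notation and system of the previous statement (linearized Euler–Maxwell in Fourier variables), there exists a functional L_ξ(t) with L_ξ(t) ∼ |(n̂, ε û, Ê, Ĥ)(t,ξ)|² (with equivalence constants independent of ε and ξ) and a constant c₀ = c₀(ρ̄, B̄, P'(ρ̄)) > 0 such that for all t > 0 and ξ ∈ ℝ³: d/dt L_ξ(t) + c₀|û|² + c₀(1+|ξ|²)/(1+ε²|ξ|²) |n̂|² + c₀/(1+ε²|ξ|²) |Ê|² + c₀|ξ|²/((1+ε²|ξ|²)(1+|ξ|²)) |Ĥ|² ≤ 0. Consequently |(n̂, ε û, Ê, Ĥ)(t,ξ)|² ≲ exp(-c₀|ξ|² t /((1+ε²|ξ|²)(1+|ξ|²))) |(n̂, ε û, Ê, Ĥ)(0,ξ)|². -/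

import Mathlib

open Complex

namespace EulerMaxwell

/-- The real part of the Hermitian product on `ℂ³`. -/
noncomputable def reInner (a b : Fin 3 → ℂ) : ℝ :=
  ∑ k, ((a k).re * (b k).re + (a k).im * (b k).im)

/-- The Fourier symbol of the gradient. -/
noncomputable def symGrad (ξ : Fin 3 → ℝ) (z : ℂ) : Fin 3 → ℂ := fun k => I * (ξ k : ℂ) * z

/-- The Fourier symbol of the divergence. -/
noncomputable def symDiv (ξ : Fin 3 → ℝ) (a : Fin 3 → ℂ) : ℂ := I * ∑ k, (ξ k : ℂ) * a k

/-- The Fourier symbol of the curl. -/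
noncomputable def symCurl (ξ : Fin 3 → ℝ) (a : Fin 3 → ℂ) : Fin 3 → ℂ :=
  fun k => I * crossProduct (fun i => (ξ i : ℂ)) a k

/-- The cross product with a real vector. -/
noncomputable def crossReal (a : Fin 3 → ℂ) (B : Fin 3 → ℝ) : Fin 3 → ℂ :=
  crossProduct a (fun i => (B i : ℂ))

lemma norm_sq_eq (z : ℂ) : ‖z‖ ^ 2 = z.re ^ 2 + z.im ^ 2 := by
  rw [Complex.sq_norm, Complex.normSq_apply]; ring

lemma reInner_self (a : Fin 3 → ℂ) : reInner a a = ∑ k, ‖a k‖ ^ 2 := by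
  refine Finset.sum_congr rfl fun k _ => ?_
  rw [norm_sq_eq]; ring

lemma reInner_comm (a b : Fin 3 → ℂ) : reInner a b = reInner b a := by
  simp only [reInner, mul_comm]

lemma reInner_add_left (a b c : Fin 3 → ℂ) :
    reInner (a + b) c = reInner a c + reInner b c := by
  simp only [reInner, Pi.add_apply, Complex.add_re, Complex.add_im, Fin.sum_univ_three]; ring

lemma reInner_smul_left (s : ℝ) (a b : Fin 3 → ℂ) :
    reInner (s • a) b = s * reInner a b := by
  simp only [reInner, Pi.smul_apply, Complex.smul_re, Complex.smul_im, Fin.sum_univ_three,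
    smul_eq_mul]; ring

lemma reInner_add_right (a b c : Fin 3 → ℂ) :
    reInner a (b + c) = reInner a b + reInner a c := by
  rw [reInner_comm, reInner_add_left, reInner_comm b, reInner_comm c]

lemma reInner_smul_right (s : ℝ) (a b : Fin 3 → ℂ) :
    reInner a (s • b) = s * reInner a b := by
  rw [reInner_comm, reInner_smul_left, reInner_comm]

lemma reInner_self_nonneg (a : Fin 3 → ℂ) : 0 ≤ reInner a a := by
  rw [reInner_self]; positivity

lemma two_mul_abs_reInner_le (s : ℝ) (a b : Fin 3 → ℂ) :
    2 * s * |reInner a b| ≤ s ^ 2 * reInner a a + reInner b b := by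
  have h1 := reInner_self_nonneg (s • a + b)
  have h2 := reInner_self_nonneg ((-s) • a + b)
  simp only [reInner_add_left, reInner_add_right, reInner_smul_left, reInner_smul_right,
    reInner_comm b a] at h1 h2
  rcases abs_cases (reInner a b) with ⟨h, _⟩ | ⟨h, _⟩ <;> rw [h] <;> nlinarith

lemma reInner_symGrad (a : Fin 3 → ℂ) (ξ : Fin 3 → ℝ) (z : ℂ) :
    reInner a (symGrad ξ z) = -(z.re * (symDiv ξ a).re + z.im * (symDiv ξ a).im) := by
  simp [reInner, symGrad, symDiv, Fin.sum_univ_three]; ring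

lemma reInner_symCurl (ξ : Fin 3 → ℝ) (a b : Fin 3 → ℂ) :
    reInner (symCurl ξ a) b = reInner a (symCurl ξ b) := by
  simp [reInner, symCurl, Fin.sum_univ_three, cross_apply]; ring

lemma reInner_symCurl_self (ξ : Fin 3 → ℝ) (a : Fin 3 → ℂ) :
    reInner (symCurl ξ a) (symCurl ξ a) =
      (∑ k, ξ k ^ 2) * reInner a a - ‖symDiv ξ a‖ ^ 2 := by
  simp [reInner, symCurl, symDiv, Fin.sum_univ_three, cross_apply, norm_sq_eq, -norm_mul]; ring

lemma reInner_symGrad_self (ξ : Fin 3 → ℝ) (z : ℂ) :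
    reInner (symGrad ξ z) (symGrad ξ z) = (∑ k, ξ k ^ 2) * ‖z‖ ^ 2 := by
  simp [reInner, symGrad, Fin.sum_univ_three, norm_sq_eq]; ring

lemma norm_symDiv_sq_le (ξ : Fin 3 → ℝ) (a : Fin 3 → ℂ) :
    ‖symDiv ξ a‖ ^ 2 ≤ (∑ k, ξ k ^ 2) * reInner a a := by
  have h := reInner_self_nonneg (symCurl ξ a)
  rw [reInner_symCurl_self] at h
  linarith

lemma reInner_crossReal (a : Fin 3 → ℂ) (B : Fin 3 → ℝ) : reInner (crossReal a B) a = 0 := by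
  simp [reInner, crossReal, Fin.sum_univ_three, cross_apply]; ring

lemma reInner_crossReal_self_le (a : Fin 3 → ℂ) (B : Fin 3 → ℝ) :
    reInner (crossReal a B) (crossReal a B) ≤ (∑ k, B k ^ 2) * reInner a a := by
  have h : reInner (crossReal a B) (crossReal a B) = reInner (symCurl B a) (symCurl B a) := by
    simp [reInner, symCurl, crossReal, Fin.sum_univ_three, cross_apply]; ring
  rw [h, reInner_symCurl_self]
  linarith [sq_nonneg ‖symDiv B a‖]

lemma hasDerivAt_re_mul_add_im_mul {f g : ℝ → ℂ} {f' g' : ℂ} {t : ℝ}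
    (hf : HasDerivAt f f' t) (hg : HasDerivAt g g' t) :
    HasDerivAt (fun s => (f s).re * (g s).re + (f s).im * (g s).im)
      ((f'.re * (g t).re + f'.im * (g t).im) + ((f t).re * g'.re + (f t).im * g'.im)) t := by
  have h1 : HasDerivAt (fun s => (f s).re) f'.re t :=
    Complex.reCLM.hasFDerivAt.comp_hasDerivAt t hf
  have h2 : HasDerivAt (fun s => (f s).im) f'.im t :=
    Complex.imCLM.hasFDerivAt.comp_hasDerivAt t hf
  have h3 : HasDerivAt (fun s => (g s).re) g'.re t :=
    Complex.reCLM.hasFDerivAt.comp_hasDerivAt t hg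
  have h4 : HasDerivAt (fun s => (g s).im) g'.im t :=
    Complex.imCLM.hasFDerivAt.comp_hasDerivAt t hg
  exact ((h1.mul h3).add (h2.mul h4)).congr_deriv (by ring)

lemma hasDerivAt_reInner {a b : ℝ → Fin 3 → ℂ} {a' b' : Fin 3 → ℂ} {t : ℝ}
    (ha : ∀ k, HasDerivAt (fun s => a s k) (a' k) t)
    (hb : ∀ k, HasDerivAt (fun s => b s k) (b' k) t) :
    HasDerivAt (fun s => reInner (a s) (b s)) (reInner a' (b t) + reInner (a t) b') t := by
  have h := HasDerivAt.fun_sum (u := Finset.univ)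
    (fun k _ => hasDerivAt_re_mul_add_im_mul (ha k) (hb k))
  exact h.congr_deriv (by rw [Finset.sum_add_distrib]; rfl)

lemma hasDerivAt_symGrad {f : ℝ → ℂ} {f' : ℂ} {t : ℝ} (ξ : Fin 3 → ℝ)
    (hf : HasDerivAt f f' t) (k : Fin 3) :
    HasDerivAt (fun s => symGrad ξ (f s) k) (symGrad ξ f' k) t :=
  hf.const_mul _

lemma hasDerivAt_symCurl {a : ℝ → Fin 3 → ℂ} {a' : Fin 3 → ℂ} {t : ℝ} (ξ : Fin 3 → ℝ)
    (ha : ∀ k, HasDerivAt (fun s => a s k) (a' k) t) (k : Fin 3) :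
    HasDerivAt (fun s => symCurl ξ (a s) k) (symCurl ξ a' k) t := by
  unfold symCurl
  refine HasDerivAt.const_mul _ ?_
  fin_cases k <;> simp only [cross_apply]
  · exact ((ha 2).const_mul _).sub ((ha 1).const_mul _)
  · exact ((ha 0).const_mul _).sub ((ha 2).const_mul _)
  · exact ((ha 1).const_mul _).sub ((ha 0).const_mul _)

/-- The squared norm of the state `(n, εu, E, H)`. -/
noncomputable def stateSq (ε : ℝ) (n : ℂ) (u E H : Fin 3 → ℂ) : ℝ :=
  ‖n‖ ^ 2 + ε ^ 2 * reInner u u + reInner E E + reInner H H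

/-- The hypocoercive Lyapunov functional; `α` and `β` stand for the weights
`(1 + ε²|ξ|²)⁻¹` and `((1 + ε²|ξ|²)(1 + |ξ|²))⁻¹`. -/
noncomputable def lyapunov (K ρ κ ε α β : ℝ) (ξ : Fin 3 → ℝ) (n : ℂ) (u E H : Fin 3 → ℂ) : ℝ :=
  K * ‖n‖ ^ 2 + ρ * ε ^ 2 * reInner u u + reInner E E + reInner H H
    + κ * α * ε ^ 2 * (reInner u (symGrad ξ n) + reInner u E)
    - κ / 4 * β * ε * reInner E (symCurl ξ H)

/-- The elementary inequalities relating the weights of the Lyapunov functional. -/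
structure IsWeight (ε r α β : ℝ) : Prop where
  α_pos : 0 < α
  α_le_one : α ≤ 1
  α_mul_le_one : α * (ε ^ 2 * r) ≤ 1
  β_pos : 0 < β
  β_le_α : β ≤ α
  β_mul_le_α : β * r ≤ α
  sq_mul_sq_le_β : ε ^ 2 * α ^ 2 ≤ β
  sq_mul_le_α : α * ε ^ 2 ≤ α

lemma isWeight {ε r : ℝ} (hε : 0 < ε) (hε1 : ε ≤ 1) (hr : 0 ≤ r) :
    IsWeight ε r (1 + ε ^ 2 * r)⁻¹ ((1 + ε ^ 2 * r) * (1 + r))⁻¹ := by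
  have he : ε ^ 2 ≤ 1 := by nlinarith
  have hD : 1 ≤ 1 + ε ^ 2 * r := by nlinarith [mul_nonneg (sq_nonneg ε) hr]
  have hD0 : 0 < 1 + ε ^ 2 * r := by linarith
  have hM0 : 0 < 1 + r := by linarith
  refine ⟨by positivity, inv_le_one_of_one_le₀ hD, ?_, by positivity, ?_, ?_, ?_, ?_⟩
  · rw [inv_mul_le_iff₀ hD0]; linarith
  · exact inv_anti₀ hD0 (by nlinarith)
  · rw [mul_inv, mul_assoc]
    refine mul_le_of_le_one_right (by positivity) ?_
    rw [inv_mul_le_iff₀ hM0]; linarith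
  · rw [inv_pow, ← div_eq_mul_inv, ← one_div, div_le_div_iff₀ (by positivity) (by positivity)]
    have h : ε ^ 2 * (1 + r) ≤ 1 + ε ^ 2 * r := by linarith
    calc ε ^ 2 * ((1 + ε ^ 2 * r) * (1 + r)) = (1 + ε ^ 2 * r) * (ε ^ 2 * (1 + r)) := by ring
      _ ≤ (1 + ε ^ 2 * r) * (1 + ε ^ 2 * r) := by gcongr
      _ = _ := by ring
  · exact mul_le_of_le_one_right (by positivity) he

/-- The cross terms are controlled by the squared norm of the state. -/
lemma abs_lyapunov_sub_le {K ρ κ ε α β : ℝ} {ξ : Fin 3 → ℝ} (hκ : 0 ≤ κ) (hε : 0 < ε)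
    (hε1 : ε ≤ 1) (hw : IsWeight ε (∑ k, ξ k ^ 2) α β) (n : ℂ) (u E H : Fin 3 → ℂ) :
    |lyapunov K ρ κ ε α β ξ n u E H -
      (K * ‖n‖ ^ 2 + ρ * ε ^ 2 * reInner u u + reInner E E + reInner H H)| ≤
      κ * stateSq ε n u E H := by
  have hr : 0 ≤ ∑ k, ξ k ^ 2 := by positivity
  have hα := hw.α_pos
  have hβ := hw.β_pos
  have hU := reInner_self_nonneg u
  have hEE := reInner_self_nonneg E
  have hHH := reInner_self_nonneg H
  have hN : 0 ≤ ‖n‖ ^ 2 := by positivity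
  have hX := two_mul_abs_reInner_le α (symGrad ξ n) u
  have hY := two_mul_abs_reInner_le 1 u E
  have hZ := two_mul_abs_reInner_le β (symCurl ξ H) E
  rw [reInner_symGrad_self, reInner_comm (symGrad ξ n) u] at hX
  rw [reInner_symCurl_self, reInner_comm (symCurl ξ H) E] at hZ
  set r := ∑ k, ξ k ^ 2
  have hX' : α * ε ^ 2 * |reInner u (symGrad ξ n)| ≤ (‖n‖ ^ 2 + ε ^ 2 * reInner u u) / 2 := by
    have h1 : ε ^ 2 * (α ^ 2 * (r * ‖n‖ ^ 2)) ≤ ‖n‖ ^ 2 := by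
      calc ε ^ 2 * (α ^ 2 * (r * ‖n‖ ^ 2)) = α * (α * (ε ^ 2 * r)) * ‖n‖ ^ 2 := by ring
        _ ≤ 1 * 1 * ‖n‖ ^ 2 := by
          gcongr
          exacts [hw.α_le_one, hw.α_mul_le_one]
        _ = _ := by ring
    have h2 := mul_le_mul_of_nonneg_left hX (sq_nonneg ε)
    nlinarith
  have hY' : α * ε ^ 2 * |reInner u E| ≤ (ε ^ 2 * reInner u u + reInner E E) / 2 := by
    have h0 : ε ^ 2 ≤ 1 := by nlinarith
    have h1 : α * ε ^ 2 * |reInner u E| ≤ ε ^ 2 * |reInner u E| := by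
      gcongr
      exact mul_le_of_le_one_left (sq_nonneg ε) hw.α_le_one
    have h2 := mul_le_mul_of_nonneg_left hY (sq_nonneg ε)
    have h3 := mul_le_mul_of_nonneg_right h0 hEE
    nlinarith
  have hZ' : β * ε * |reInner E (symCurl ξ H)| ≤ (reInner E E + reInner H H) / 2 := by
    have h1 : β ^ 2 * (r * reInner H H) ≤ reInner H H := by
      calc β ^ 2 * (r * reInner H H) = β * (β * r) * reInner H H := by ring
        _ ≤ 1 * 1 * reInner H H := by
          gcongr
          exacts [hw.β_le_α.trans hw.α_le_one, hw.β_mul_le_α.trans hw.α_le_one]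
        _ = _ := by ring
    have h2 : β * ε * |reInner E (symCurl ξ H)| ≤ β * |reInner E (symCurl ξ H)| := by
      gcongr
      exact mul_le_of_le_one_right hβ.le hε1
    have h3 : 0 ≤ β ^ 2 * ‖symDiv ξ H‖ ^ 2 := by positivity
    nlinarith
  have hsum : |lyapunov K ρ κ ε α β ξ n u E H -
      (K * ‖n‖ ^ 2 + ρ * ε ^ 2 * reInner u u + reInner E E + reInner H H)| ≤
      κ * (α * ε ^ 2 * |reInner u (symGrad ξ n)|) + κ * (α * ε ^ 2 * |reInner u E|)
        + κ / 4 * (β * ε * |reInner E (symCurl ξ H)|) := by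
    have e : lyapunov K ρ κ ε α β ξ n u E H -
      (K * ‖n‖ ^ 2 + ρ * ε ^ 2 * reInner u u + reInner E E + reInner H H) =
      κ * (α * ε ^ 2 * reInner u (symGrad ξ n)) + κ * (α * ε ^ 2 * reInner u E)
        + -(κ / 4 * (β * ε * reInner E (symCurl ξ H))) := by
      unfold lyapunov; ring
    rw [e]
    refine (abs_add_three _ _ _).trans (le_of_eq ?_)
    simp only [abs_neg, abs_mul, abs_of_nonneg hκ, abs_of_pos hα, abs_of_pos hβ, abs_of_pos hε,
      abs_of_nonneg (sq_nonneg ε), abs_of_nonneg (div_nonneg hκ (by norm_num : (0 : ℝ) ≤ 4))]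
  refine hsum.trans ?_
  have hS : α * ε ^ 2 * |reInner u (symGrad ξ n)| + α * ε ^ 2 * |reInner u E|
      + 1 / 4 * (β * ε * |reInner E (symCurl ξ H)|) ≤ stateSq ε n u E H := by
    unfold stateSq; linarith
  calc _ = κ * (α * ε ^ 2 * |reInner u (symGrad ξ n)| + α * ε ^ 2 * |reInner u E|
      + 1 / 4 * (β * ε * |reInner E (symCurl ξ H)|)) := by ring
    _ ≤ _ := by gcongr

/-- The time derivative of the Lyapunov functional along the Euler–Maxwell system. -/
noncomputable def lyapunovRate (K ρ Pp κ ε α β : ℝ) (ξ B : Fin 3 → ℝ) (n : ℂ)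
    (u E H : Fin 3 → ℂ) : ℝ :=
  -2 * ρ * reInner u u
    + κ * α * (-((∑ k, ξ k ^ 2) * ‖n‖ ^ 2 + 2 * K * ‖n‖ ^ 2 + reInner E E)
      - reInner u (symGrad ξ n) - ε * reInner (crossReal u B) (symGrad ξ n)
      - reInner u E - ε * reInner (crossReal u B) E
      + ε ^ 2 * Pp * ‖symDiv ξ u‖ ^ 2 + ε ^ 2 * ρ * reInner u u + ε * reInner u (symCurl ξ H))
    - κ / 4 * β * ((∑ k, ξ k ^ 2) * reInner H H + ε * ρ * reInner u (symCurl ξ H)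
      - reInner (symCurl ξ E) (symCurl ξ E))

lemma symCurl_smul (ξ : Fin 3 → ℝ) (s : ℝ) (a : Fin 3 → ℂ) :
    symCurl ξ (s • a) = s • symCurl ξ a := by
  ext k
  fin_cases k <;> simp [symCurl, cross_apply] <;> ring

lemma symGrad_real_mul (ξ : Fin 3 → ℝ) (s : ℝ) (z : ℂ) :
    symGrad ξ ((s : ℂ) * z) = s • symGrad ξ z := by
  ext k
  simp [symGrad]; ring

lemma hasDerivAt_lyapunov {K ρ Pp κ ε α β : ℝ} {ξ B : Fin 3 → ℝ} {n : ℝ → ℂ}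
    {u E H : ℝ → Fin 3 → ℂ} {t : ℝ} (hε : 0 < ε) (hK : K * Pp = ρ)
    (hn : HasDerivAt n (((-Pp : ℝ) : ℂ) * symDiv ξ (u t)) t)
    (hu : ∀ k, HasDerivAt (fun s => u s k)
      (((-(ε ^ 2)⁻¹) • (symGrad ξ (n t) + E t + u t + ε • crossReal (u t) B)) k) t)
    (hE : ∀ k, HasDerivAt (fun s => E s k) ((ε⁻¹ • symCurl ξ (H t) + ρ • u t) k) t)
    (hH : ∀ k, HasDerivAt (fun s => H s k) (((-ε⁻¹) • symCurl ξ (E t)) k) t)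
    (hdE : symDiv ξ (E t) = ((-K : ℝ) : ℂ) * n t) (hdH : symDiv ξ (H t) = 0) :
    HasDerivAt (fun s => lyapunov K ρ κ ε α β ξ (n s) (u s) (E s) (H s))
      (lyapunovRate K ρ Pp κ ε α β ξ B (n t) (u t) (E t) (H t)) t := by
  have hN : HasDerivAt (fun s => ‖n s‖ ^ 2) (2 * Pp * reInner (u t) (symGrad ξ (n t))) t := by
    have h := hasDerivAt_re_mul_add_im_mul hn hn
    simp only [← sq, ← norm_sq_eq] at h
    refine h.congr_deriv ?_
    rw [reInner_symGrad, Complex.re_ofReal_mul, Complex.im_ofReal_mul]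
    ring
  have hX := hasDerivAt_reInner hu (hasDerivAt_symGrad ξ hn)
  have hY := hasDerivAt_reInner hu hE
  have hZ := hasDerivAt_reInner hE (hasDerivAt_symCurl ξ hH)
  have hL := (((((hN.const_mul K).add ((hasDerivAt_reInner hu hu).const_mul (ρ * ε ^ 2))).add
    (hasDerivAt_reInner hE hE)).add (hasDerivAt_reInner hH hH)).add
    ((hX.add hY).const_mul (κ * α * ε ^ 2))).sub (hZ.const_mul (κ / 4 * β * ε))
  refine hL.congr_deriv ?_
  have e1 : reInner (u t) (symGrad ξ (symDiv ξ (u t))) = -‖symDiv ξ (u t)‖ ^ 2 := by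
    rw [reInner_symGrad, norm_sq_eq]; ring
  have e2 : reInner (E t) (symGrad ξ (n t)) = K * ‖n t‖ ^ 2 := by
    rw [reInner_symGrad, hdE, norm_sq_eq, Complex.re_ofReal_mul, Complex.im_ofReal_mul]; ring
  have e3 : reInner (symCurl ξ (H t)) (symCurl ξ (H t)) =
      (∑ k, ξ k ^ 2) * reInner (H t) (H t) := by
    rw [reInner_symCurl_self, hdH]; simp
  have e4 : reInner (E t) (symCurl ξ (symCurl ξ (E t))) =
      reInner (symCurl ξ (E t)) (symCurl ξ (E t)) := (reInner_symCurl ξ _ _).symm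
  have e5 : reInner (symGrad ξ (n t)) (E t) = K * ‖n t‖ ^ 2 := by rw [reInner_comm, e2]
  simp only [symCurl_smul, symGrad_real_mul, reInner_add_left, reInner_add_right,
    reInner_smul_left, reInner_smul_right, e1, e2, e3, e4, e5, reInner_symGrad_self,
    reInner_crossReal, lyapunovRate, reInner_comm (E t) (u t),
    reInner_comm (symGrad ξ (n t)) (u t), reInner_comm (u t) (crossReal (u t) B),
    reInner_symCurl ξ (H t) (E t), reInner_symCurl ξ (E t) (H t),
    reInner_comm (H t) (symCurl ξ (E t))]
  subst hK
  field_simp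
  ring

/-- Dissipation produced by the Lyapunov functional when the coupling `κ` is small. -/
lemma lyapunovRate_le {K ρ Pp κ ε α β : ℝ} {ξ B : Fin 3 → ℝ} (hκ : 0 ≤ κ) (hρ : 0 ≤ ρ)
    (hPp : 0 ≤ Pp) (hε : 0 < ε) (hε1 : ε ≤ 1)
    (hκρ : κ * (6 + 2 * (∑ k, B k ^ 2) + Pp + ρ + ρ ^ 2) ≤ ρ)
    (hw : IsWeight ε (∑ k, ξ k ^ 2) α β) (n : ℂ) (u E H : Fin 3 → ℂ) :
    lyapunovRate K ρ Pp κ ε α β ξ B n u E H ≤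
      -(ρ * reInner u u + κ * α * ((∑ k, ξ k ^ 2) / 2 + 2 * K) * ‖n‖ ^ 2
        + κ / 4 * α * reInner E E + κ / 8 * (β * (∑ k, ξ k ^ 2)) * reInner H H) := by
  have hr : 0 ≤ ∑ k, ξ k ^ 2 := by positivity
  have hα := hw.α_pos
  have hβ := hw.β_pos
  have hU := reInner_self_nonneg u
  have hEE := reInner_self_nonneg E
  have hHH := reInner_self_nonneg H
  have hB := reInner_crossReal_self_le u B
  have hS := norm_symDiv_sq_le ξ u
  have hT : reInner (symCurl ξ E) (symCurl ξ E) ≤ (∑ k, ξ k ^ 2) * reInner E E := by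
    rw [reInner_symCurl_self]; linarith [sq_nonneg ‖symDiv ξ E‖]
  have hC : reInner (symCurl ξ H) (symCurl ξ H) ≤ (∑ k, ξ k ^ 2) * reInner H H := by
    rw [reInner_symCurl_self]; linarith [sq_nonneg ‖symDiv ξ H‖]
  have ha1 := two_mul_abs_reInner_le 2 u (symGrad ξ n)
  have ha2 := two_mul_abs_reInner_le 2 (crossReal u B) (symGrad ξ n)
  have hy1 := two_mul_abs_reInner_le 2 u E
  have hy2 := two_mul_abs_reInner_le 2 (crossReal u B) E
  have hw1 := two_mul_abs_reInner_le (ε * α / 8) (symCurl ξ H) u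
  have hw2 := two_mul_abs_reInner_le (2 * ρ) u (symCurl ξ H)
  rw [reInner_comm (symCurl ξ H) u] at hw1
  rw [reInner_symGrad_self] at ha1 ha2
  unfold lyapunovRate
  set r := ∑ k, ξ k ^ 2
  set b := ∑ k, B k ^ 2
  have hb : 0 ≤ b := by positivity
  have ha2' : ε * |reInner (crossReal u B) (symGrad ξ n)| ≤
      |reInner (crossReal u B) (symGrad ξ n)| := mul_le_of_le_one_left (abs_nonneg _) hε1
  have hy2' : ε * |reInner (crossReal u B) E| ≤
      |reInner (crossReal u B) E| := mul_le_of_le_one_left (abs_nonneg _) hε1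
  have m1 := neg_abs_le (reInner u (symGrad ξ n))
  have m2 := mul_le_mul_of_nonneg_left (neg_abs_le (reInner (crossReal u B) (symGrad ξ n))) hε.le
  have m3 := neg_abs_le (reInner u E)
  have m4 := mul_le_mul_of_nonneg_left (neg_abs_le (reInner (crossReal u B) E)) hε.le
  set W := reInner u (symCurl ξ H)
  have hquad : -(r * ‖n‖ ^ 2 + 2 * K * ‖n‖ ^ 2 + reInner E E)
      - reInner u (symGrad ξ n) - ε * reInner (crossReal u B) (symGrad ξ n)
      - reInner u E - ε * reInner (crossReal u B) E ≤
      -((r / 2 + 2 * K) * ‖n‖ ^ 2 + reInner E E / 2) + (2 + 2 * b) * reInner u u := by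
    linarith
  have hquad' := mul_le_mul_of_nonneg_left hquad hα.le
  have hUα : α * ((2 + 2 * b) * reInner u u) ≤ (2 + 2 * b) * reInner u u :=
    mul_le_of_le_one_left (by positivity) hw.α_le_one
  have hS' : α * (ε ^ 2 * Pp * ‖symDiv ξ u‖ ^ 2) ≤ Pp * reInner u u := by
    calc α * (ε ^ 2 * Pp * ‖symDiv ξ u‖ ^ 2) ≤ α * (ε ^ 2 * Pp * (r * reInner u u)) := by gcongr
      _ = α * (ε ^ 2 * r) * (Pp * reInner u u) := by ring
      _ ≤ 1 * (Pp * reInner u u) := by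
        gcongr
        exact hw.α_mul_le_one
      _ = _ := one_mul _
  have hρU : α * (ε ^ 2 * ρ * reInner u u) ≤ ρ * reInner u u := by
    calc α * (ε ^ 2 * ρ * reInner u u) = α * ε ^ 2 * (ρ * reInner u u) := by ring
      _ ≤ 1 * (ρ * reInner u u) := by
        gcongr
        exact hw.sq_mul_le_α.trans hw.α_le_one
      _ = _ := one_mul _
  have hW1 : α * (ε * W) ≤ β * r * reInner H H / 16 + 4 * reInner u u := by
    have h1 : α * ε * W ≤ α * ε * |W| := by gcongr; exact le_abs_self W
    have h2 : ε ^ 2 * α ^ 2 * reInner (symCurl ξ H) (symCurl ξ H) ≤ β * (r * reInner H H) := by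
      gcongr
      exacts [reInner_self_nonneg _, hw.sq_mul_sq_le_β]
    nlinarith
  have hW2 : -(β * (ε * ρ * W)) ≤ β * r * reInner H H / 4 + ρ ^ 2 * reInner u u := by
    have h1 : -(ε * ρ * W) ≤ ρ * |W| := by
      calc -(ε * ρ * W) = ε * (ρ * -W) := by ring
        _ ≤ ε * (ρ * |W|) := by gcongr; exact neg_le_abs W
        _ ≤ ρ * |W| := mul_le_of_le_one_left (by positivity) hε1
    have h2 : -(ε * ρ * W) ≤ r * reInner H H / 4 + ρ ^ 2 * reInner u u := by linarith
    have h3 := mul_le_mul_of_nonneg_left h2 hβ.le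
    have h4 : β * (ρ ^ 2 * reInner u u) ≤ ρ ^ 2 * reInner u u :=
      mul_le_of_le_one_left (by positivity) (hw.β_le_α.trans hw.α_le_one)
    linarith
  have hT' : β * reInner (symCurl ξ E) (symCurl ξ E) ≤ α * reInner E E := by
    calc β * reInner (symCurl ξ E) (symCurl ξ E) ≤ β * (r * reInner E E) := by gcongr
      _ = β * r * reInner E E := by ring
      _ ≤ _ := by
        gcongr
        exact hw.β_mul_le_α
  have hmain := mul_le_mul_of_nonneg_left
    (add_le_add (add_le_add (add_le_add hquad' hS') (add_le_add hρU hW1))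
      (mul_le_mul_of_nonneg_left (add_le_add hW2 hT') (by norm_num : (0 : ℝ) ≤ 1 / 4))) hκ
  have hUα' := mul_le_mul_of_nonneg_left hUα hκ
  have hκU := mul_le_mul_of_nonneg_right hκρ hU
  have hρ2 : 0 ≤ κ * (ρ ^ 2 * reInner u u) := by positivity
  have hHβ : 0 ≤ κ * (β * r * reInner H H) := by positivity
  linarith

lemma le_exp_mul_of_hasDerivAt {L L' : ℝ → ℝ} {c : ℝ} (hL : ∀ t, HasDerivAt L (L' t) t)
    (h : ∀ t, 0 < t → L' t ≤ -c * L t) {t : ℝ} (ht : 0 ≤ t) :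
    L t ≤ Real.exp (-c * t) * L 0 := by
  have hd : ∀ s, HasDerivAt (fun s => Real.exp (c * s) * L s)
      (Real.exp (c * s) * (c * L s + L' s)) s := fun s =>
    (((hasDerivAt_id s).const_mul c).exp.mul (hL s)).congr_deriv (by simp; ring)
  have hanti : AntitoneOn (fun s => Real.exp (c * s) * L s) (Set.Ici 0) := by
    refine antitoneOn_of_deriv_nonpos (convex_Ici 0)
      (fun s _ => (hd s).continuousAt.continuousWithinAt)
      (fun s _ => (hd s).differentiableAt.differentiableWithinAt) fun s hs => ?_
    rw [interior_Ici] at hs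
    rw [(hd s).deriv]
    exact mul_nonpos_of_nonneg_of_nonpos (Real.exp_pos _).le (by linarith [h s hs])
  have h0 := hanti (Set.mem_Ici.2 le_rfl) (Set.mem_Ici.2 ht) ht
  simp only [mul_zero, Real.exp_zero, one_mul] at h0
  calc L t = Real.exp (-c * t) * (Real.exp (c * t) * L t) := by
        rw [← mul_assoc, ← Real.exp_add]; simp
    _ ≤ _ := by gcongr

lemma stateSq_nonneg (ε : ℝ) (n : ℂ) (u E H : Fin 3 → ℂ) : 0 ≤ stateSq ε n u E H := by
  have := reInner_self_nonneg u
  have := reInner_self_nonneg E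
  have := reInner_self_nonneg H
  unfold stateSq
  positivity

lemma lyapunov_equiv {K ρ κ m ε α β : ℝ} {ξ : Fin 3 → ℝ} (hK : 0 ≤ K) (hρ : 0 ≤ ρ)
    (hκ : 0 ≤ κ) (hκm : κ ≤ m) (hm : 2 * m ≤ 1) (hmK : 2 * m ≤ K) (hmρ : 2 * m ≤ ρ)
    (hε : 0 < ε) (hε1 : ε ≤ 1) (hw : IsWeight ε (∑ k, ξ k ^ 2) α β)
    (n : ℂ) (u E H : Fin 3 → ℂ) :
    m * stateSq ε n u E H ≤ lyapunov K ρ κ ε α β ξ n u E H ∧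
      lyapunov K ρ κ ε α β ξ n u E H ≤ (K + ρ + 2) * stateSq ε n u E H := by
  have h := abs_le.1 (abs_lyapunov_sub_le (K := K) (ρ := ρ) hκ hε hε1 hw n u E H)
  have hN : 0 ≤ ‖n‖ ^ 2 := by positivity
  have hU : 0 ≤ ε ^ 2 * reInner u u := mul_nonneg (sq_nonneg ε) (reInner_self_nonneg u)
  have hEE := reInner_self_nonneg E
  have hHH := reInner_self_nonneg H
  have hS := mul_le_mul_of_nonneg_right hκm (stateSq_nonneg ε n u E H)
  have hS1 := mul_le_mul_of_nonneg_right hm (stateSq_nonneg ε n u E H)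
  unfold stateSq at *
  constructor
  · nlinarith [mul_le_mul_of_nonneg_right hmK hN, mul_le_mul_of_nonneg_right hmρ hU,
      mul_le_mul_of_nonneg_right hm hEE, mul_le_mul_of_nonneg_right hm hHH]
  · nlinarith [mul_nonneg hK hN, mul_nonneg hK hU, mul_nonneg hK hEE, mul_nonneg hK hHH,
      mul_nonneg hρ hN, mul_nonneg hρ hU, mul_nonneg hρ hEE, mul_nonneg hρ hHH]

lemma dissipation_le {K ρ κ d ε r α β : ℝ} (hr : 0 ≤ r) (hdρ : d ≤ ρ) (hdK : d ≤ 2 * K * κ)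
    (hdκ : d ≤ κ / 8) (hκ : 0 ≤ κ) (hw : IsWeight ε r α β) {N U EE HH : ℝ} (hN : 0 ≤ N)
    (hU : 0 ≤ U) (hEE : 0 ≤ EE) (hHH : 0 ≤ HH) :
    d * U + d * (α * (1 + r)) * N + d * α * EE + d * (β * r) * HH ≤
      ρ * U + κ * α * (r / 2 + 2 * K) * N + κ / 4 * α * EE + κ / 8 * (β * r) * HH := by
  have hα := hw.α_pos
  have hβ := hw.β_pos
  have h1 : d * (1 + r) ≤ κ * (r / 2 + 2 * K) := by nlinarith
  have h2 : d * (α * (1 + r)) ≤ κ * α * (r / 2 + 2 * K) := by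
    calc d * (α * (1 + r)) = α * (d * (1 + r)) := by ring
      _ ≤ α * (κ * (r / 2 + 2 * K)) := by gcongr
      _ = _ := by ring
  have h3 : d ≤ κ / 4 := by linarith
  gcongr

lemma mul_stateSq_le_dissipation {ε r α β d : ℝ} (hd : 0 ≤ d) (hr : 0 ≤ r) (hε : 0 < ε)
    (hε1 : ε ≤ 1) (hw : IsWeight ε r α β) (n : ℂ) (u E H : Fin 3 → ℂ) :
    d * (β * r) * stateSq ε n u E H ≤
      d * reInner u u + d * (α * (1 + r)) * ‖n‖ ^ 2 + d * α * reInner E E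
        + d * (β * r) * reInner H H := by
  have hα := hw.α_pos
  have hβ := hw.β_pos
  have hU := reInner_self_nonneg u
  have hEE := reInner_self_nonneg E
  have h1 : β * r * ε ^ 2 ≤ 1 := by
    have h0 : ε ^ 2 ≤ 1 := by nlinarith
    calc β * r * ε ^ 2 ≤ 1 * 1 := by
          gcongr
          exact hw.β_mul_le_α.trans hw.α_le_one
      _ = 1 := one_mul 1
  have h2 : β * r ≤ α * (1 + r) := by nlinarith [hw.β_mul_le_α, mul_nonneg hα.le hr]
  have h3 := mul_le_mul_of_nonneg_right h1 hU
  have h4 := mul_le_mul_of_nonneg_right h2 (sq_nonneg ‖n‖)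
  have h5 := mul_le_mul_of_nonneg_right hw.β_mul_le_α hEE
  have h6 := mul_le_mul_of_nonneg_left (add_le_add (add_le_add h3 h4) h5) hd
  unfold stateSq
  linarith

end EulerMaxwell

open EulerMaxwell
/-- Hypocoercive Lyapunov functional and pointwise decay for the
Fourier-transformed linearized Euler–Maxwell system.  There exist `c₀ > 0` and
equivalence/decay constants `C₁, C₂, C₃ > 0` depending only on `ρ̄, B̄, P'(ρ̄)`
(independent of `ε` and `ξ`) such that for every solution there is a functional
`L_ξ(t) ∼ |(n̂, εû, Ê, Ĥ)(t)|²` satisfying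
`d/dt L_ξ + c₀|û|² + c₀(1+|ξ|²)/(1+ε²|ξ|²)|n̂|² + c₀/(1+ε²|ξ|²)|Ê|²
 + c₀|ξ|²/((1+ε²|ξ|²)(1+|ξ|²))|Ĥ|² ≤ 0`, and consequently
`|(n̂,εû,Ê,Ĥ)(t)|² ≤ C₃ exp(-c₀|ξ|²t/((1+ε²|ξ|²)(1+|ξ|²))) |(n̂,εû,Ê,Ĥ)(0)|²`. -/
theorem euler_maxwell_fourier_hypocoercivity
    (Pp ρbar K : ℝ) (hPp : 0 < Pp) (hρ : 0 < ρbar) (hK : K = ρbar / Pp)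
    (Bbar : Fin 3 → ℝ) :
    ∃ c₀ C₁ C₂ C₃ : ℝ, 0 < c₀ ∧ 0 < C₁ ∧ 0 < C₂ ∧ 0 < C₃ ∧
      ∀ (ε : ℝ), 0 < ε → ε ≤ 1 → ∀ (ξ : Fin 3 → ℝ)
        (n : ℝ → ℂ) (u E H : ℝ → Fin 3 → ℂ),
        (∀ t, HasDerivAt n (-(Pp : ℂ) * (Complex.I * ∑ k, (ξ k : ℂ) * u t k)) t) →
        (∀ t k, HasDerivAt (fun s => u s k)
          (-(ε : ℂ) ^ (-2 : ℤ) * (Complex.I * (ξ k : ℂ) * n t + E t k + u t k +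
            (ε : ℂ) * crossProduct (u t) (fun i => (Bbar i : ℂ)) k)) t) →
        (∀ t k, HasDerivAt (fun s => E s k)
          ((ε : ℂ)⁻¹ * (Complex.I * crossProduct (fun i => (ξ i : ℂ)) (H t) k +
            (ε : ℂ) * (ρbar : ℂ) * u t k)) t) →
        (∀ t k, HasDerivAt (fun s => H s k)
          (-(ε : ℂ)⁻¹ * (Complex.I * crossProduct (fun i => (ξ i : ℂ)) (E t) k)) t) →
        (∀ t, Complex.I * ∑ k, (ξ k : ℂ) * E t k = -(K : ℂ) * n t) →
        (∀ t, ∑ k, (ξ k : ℂ) * H t k = 0) →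
        ∃ L L' : ℝ → ℝ,
          -- `L_ξ(t) ∼ |(n̂, εû, Ê, Ĥ)(t)|²` with constants independent of `ε, ξ`
          (∀ t, C₁ * (‖n t‖ ^ 2 + ε ^ 2 * ∑ k, ‖u t k‖ ^ 2 + ∑ k, ‖E t k‖ ^ 2 +
              ∑ k, ‖H t k‖ ^ 2) ≤ L t ∧
            L t ≤ C₂ * (‖n t‖ ^ 2 + ε ^ 2 * ∑ k, ‖u t k‖ ^ 2 + ∑ k, ‖E t k‖ ^ 2 +
              ∑ k, ‖H t k‖ ^ 2)) ∧
          (∀ t, HasDerivAt L (L' t) t) ∧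
          -- the Lyapunov differential inequality
          (∀ t, 0 < t →
            L' t + c₀ * ∑ k, ‖u t k‖ ^ 2 +
              c₀ * (1 + ∑ k, (ξ k) ^ 2) / (1 + ε ^ 2 * ∑ k, (ξ k) ^ 2) * ‖n t‖ ^ 2 +
              c₀ / (1 + ε ^ 2 * ∑ k, (ξ k) ^ 2) * ∑ k, ‖E t k‖ ^ 2 +
              c₀ * (∑ k, (ξ k) ^ 2) /
                ((1 + ε ^ 2 * ∑ k, (ξ k) ^ 2) * (1 + ∑ k, (ξ k) ^ 2)) *
                ∑ k, ‖H t k‖ ^ 2 ≤ 0) ∧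
          -- the resulting pointwise decay estimate
          (∀ t, 0 ≤ t →
            ‖n t‖ ^ 2 + ε ^ 2 * ∑ k, ‖u t k‖ ^ 2 + ∑ k, ‖E t k‖ ^ 2 +
                ∑ k, ‖H t k‖ ^ 2 ≤
              C₃ * Real.exp (-(c₀ * (∑ k, (ξ k) ^ 2) /
                  ((1 + ε ^ 2 * ∑ k, (ξ k) ^ 2) * (1 + ∑ k, (ξ k) ^ 2))) * t) *
                (‖n 0‖ ^ 2 + ε ^ 2 * ∑ k, ‖u 0 k‖ ^ 2 + ∑ k, ‖E 0 k‖ ^ 2 +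
                  ∑ k, ‖H 0 k‖ ^ 2)) := by
  have hK0 : 0 < K := hK ▸ div_pos hρ hPp
  have hKP : K * Pp = ρbar := by rw [hK]; field_simp
  set b := ∑ k, Bbar k ^ 2
  have hb : 0 ≤ b := by positivity
  obtain ⟨m, hm0, hm1, hmK, hmρ⟩ : ∃ m : ℝ, 0 < m ∧ 2 * m ≤ 1 ∧ 2 * m ≤ K ∧ 2 * m ≤ ρbar :=
    ⟨min 1 (min K ρbar) / 2, by positivity,
      by linarith [min_le_left 1 (min K ρbar)],
      by linarith [min_le_right 1 (min K ρbar), min_le_left K ρbar],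
      by linarith [min_le_right 1 (min K ρbar), min_le_right K ρbar]⟩
  have hQ : 0 < 6 + 2 * b + Pp + ρbar + ρbar ^ 2 := by positivity
  obtain ⟨κ, hκ0, hκm, hκρ⟩ : ∃ κ : ℝ, 0 < κ ∧ κ ≤ m ∧
      κ * (6 + 2 * b + Pp + ρbar + ρbar ^ 2) ≤ ρbar :=
    ⟨min m (ρbar / (6 + 2 * b + Pp + ρbar + ρbar ^ 2)), by positivity, min_le_left _ _,
      (le_div_iff₀ hQ).1 (min_le_right _ _)⟩
  obtain ⟨d, hd0, hdρ, hdK, hdκ⟩ : ∃ d : ℝ, 0 < d ∧ d ≤ ρbar ∧ d ≤ 2 * K * κ ∧ d ≤ κ / 8 :=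
    ⟨min ρbar (min (2 * K * κ) (κ / 8)), by positivity, min_le_left _ _,
      (min_le_right _ _).trans (min_le_left _ _), (min_le_right _ _).trans (min_le_right _ _)⟩
  have hC : 0 < K + ρbar + 2 := by positivity
  refine ⟨d / (K + ρbar + 2), m, K + ρbar + 2, (K + ρbar + 2) / m, by positivity, hm0, hC,
    by positivity, ?_⟩
  intro ε hε hε1 ξ n u E H hn hu hE hH hdE hdH
  have hr : 0 ≤ ∑ k, ξ k ^ 2 := by positivity
  have hw := isWeight hε hε1 hr
  simp only [← reInner_self]
  simp only [div_eq_mul_inv _ ((1 + ε ^ 2 * ∑ k, ξ k ^ 2) * (1 + ∑ k, ξ k ^ 2)),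
    div_eq_mul_inv _ (1 + ε ^ 2 * ∑ k, ξ k ^ 2)]
  set α := (1 + ε ^ 2 * ∑ k, ξ k ^ 2)⁻¹
  set β := ((1 + ε ^ 2 * ∑ k, ξ k ^ 2) * (1 + ∑ k, ξ k ^ 2))⁻¹
  have hεC : (ε : ℂ) ≠ 0 := by exact_mod_cast hε.ne'
  have hderiv : ∀ t, HasDerivAt (fun s => lyapunov K ρbar κ ε α β ξ (n s) (u s) (E s) (H s))
      (lyapunovRate K ρbar Pp κ ε α β ξ Bbar (n t) (u t) (E t) (H t)) t := by
    intro t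
    refine hasDerivAt_lyapunov hε hKP ?_ (fun k => ?_) (fun k => ?_) (fun k => ?_) ?_ ?_
    · exact (hn t).congr_deriv (by simp [symDiv])
    · exact (hu t k).congr_deriv (by simp [symGrad, crossReal, zpow_neg]; ring)
    · refine (hE t k).congr_deriv ?_
      simp [symCurl]
      field_simp
    · exact (hH t k).congr_deriv (by simp [symCurl])
    · simpa [symDiv] using hdE t
    · simp [symDiv, hdH t]
  have hequiv := fun t => lyapunov_equiv hK0.le hρ.le hκ0.le hκm hm1 hmK hmρ hε hε1 hw
    (n t) (u t) (E t) (H t)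
  have hrate : ∀ t, lyapunovRate K ρbar Pp κ ε α β ξ Bbar (n t) (u t) (E t) (H t) ≤
      -(d * reInner (u t) (u t) + d * (α * (1 + ∑ k, ξ k ^ 2)) * ‖n t‖ ^ 2
        + d * α * reInner (E t) (E t) + d * (β * ∑ k, ξ k ^ 2) * reInner (H t) (H t)) :=
    fun t => (lyapunovRate_le hκ0.le hρ.le hPp.le hε hε1 hκρ hw _ _ _ _).trans
      (neg_le_neg (dissipation_le hr hdρ hdK hdκ hκ0.le hw (sq_nonneg _)
        (reInner_self_nonneg _) (reInner_self_nonneg _) (reInner_self_nonneg _)))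
  have hα := hw.α_pos
  have hβ := hw.β_pos
  refine ⟨_, _, hequiv, hderiv, fun t _ => ?_, fun t ht => ?_⟩
  · have hc : d / (K + ρbar + 2) ≤ d := div_le_self hd0.le (by linarith)
    have hU := reInner_self_nonneg (u t)
    have hEE := reInner_self_nonneg (E t)
    have hHH := reInner_self_nonneg (H t)
    have hdiss : 0 ≤ reInner (u t) (u t) + α * (1 + ∑ k, ξ k ^ 2) * ‖n t‖ ^ 2
        + α * reInner (E t) (E t) + β * (∑ k, ξ k ^ 2) * reInner (H t) (H t) := by positivity
    have h1 := mul_le_mul_of_nonneg_right hc hdiss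
    have h2 := hrate t
    simp only [add_assoc] at *
    linarith
  · have hdecay := le_exp_mul_of_hasDerivAt (c := d / (K + ρbar + 2) * (∑ k, ξ k ^ 2) * β)
      hderiv (fun s _ => ?_) ht
    · have h0 := mul_le_mul_of_nonneg_left (hequiv 0).2
        (Real.exp_pos (-(d / (K + ρbar + 2) * (∑ k, ξ k ^ 2) * β) * t)).le
      have h1 := ((hequiv t).1.trans hdecay).trans h0
      change stateSq ε (n t) (u t) (E t) (H t) ≤ _ * stateSq ε (n 0) (u 0) (E 0) (H 0)
      rw [div_mul_eq_mul_div, div_mul_eq_mul_div, le_div_iff₀ hm0]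
      linarith
    · have h1 := mul_stateSq_le_dissipation hd0.le hr hε hε1 hw (n s) (u s) (E s) (H s)
      have h2 : d / (K + ρbar + 2) * (∑ k, ξ k ^ 2) * β *
          lyapunov K ρbar κ ε α β ξ (n s) (u s) (E s) (H s) ≤
          d * (β * ∑ k, ξ k ^ 2) * stateSq ε (n s) (u s) (E s) (H s) := by
        calc _ ≤ d / (K + ρbar + 2) * (∑ k, ξ k ^ 2) * β *
              ((K + ρbar + 2) * stateSq ε (n s) (u s) (E s) (H s)) := by
              gcongr
              exact (hequiv s).2
          _ = _ := by field_simp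
      linarith [hrate s]
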